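/- Let A, R ≥ 0, a, r > 0, d ≥ 0 and δ > 0. The Morse-type interaction force (x,y) ↦ K(d,x,y) is Lipschitz continuous on the set {(x,y) ∈ ℝ² × ℝ² : ‖x − y‖ ≥ δ}; that is, there exists L > 0 such that ‖K(d,x,y) − K(d,x',y')‖ ≤ L·(‖x − x'‖ + ‖y − y'‖) for all pairs (x,y), (x',y') in this set. -/

import Mathlib

/-- The Morse-type interaction force with body size `d`. -/
noncomputable def morseK (A R a r d : ℝ) (x y : EuclideanSpace ℝ (Fin 2)) :
    EuclideanSpace ℝ (Fin 2) :=
  ((A / a) * Real.exp ((d - ‖x - y‖) / a) - (R / r) * Real.exp ((d - ‖x - y‖) / r)) •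
    (‖x - y‖⁻¹ • (x - y))

lemma abs_exp_sub_exp_le {u v M : ℝ} (hu : u ≤ M) (hv : v ≤ M) :
    |Real.exp u - Real.exp v| ≤ Real.exp M * |u - v| := by
  wlog h : v ≤ u generalizing u v
  · rw [abs_sub_comm, abs_sub_comm u]
    exact this hv hu (le_of_not_ge h)
  rw [abs_of_nonneg (sub_nonneg.2 (Real.exp_le_exp.2 h)), abs_of_nonneg (sub_nonneg.2 h)]
  calc Real.exp u - Real.exp v = Real.exp u * (1 - Real.exp (v - u)) := by
        rw [mul_sub, ← Real.exp_add]; simp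
    _ ≤ Real.exp u * (u - v) := by
        refine mul_le_mul_of_nonneg_left ?_ (Real.exp_pos u).le
        linarith [Real.add_one_le_exp (v - u)]
    _ ≤ Real.exp M * (u - v) := by
        have := sub_nonneg.2 h
        gcongr

lemma abs_mul_exp_sub_mul_exp_le {c a d s t : ℝ} (hc : 0 ≤ c) (ha : 0 < a)
    (hs : 0 ≤ s) (ht : 0 ≤ t) :
    |c * Real.exp ((d - s) / a) - c * Real.exp ((d - t) / a)| ≤
      c * Real.exp (d / a) / a * |s - t| := by
  have h : |Real.exp ((d - s) / a) - Real.exp ((d - t) / a)| ≤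
      Real.exp (d / a) * |(d - s) / a - (d - t) / a| :=
    abs_exp_sub_exp_le (by gcongr; linarith) (by gcongr; linarith)
  have h' : |(d - s) / a - (d - t) / a| = |s - t| / a := by
    rw [← sub_div, abs_div, abs_of_pos ha, abs_sub_comm s t]
    congr 2
    ring
  rw [h'] at h
  rw [← mul_sub, abs_mul, abs_of_nonneg hc]
  calc _ ≤ c * (Real.exp (d / a) * (|s - t| / a)) := by gcongr
    _ = _ := by ring

lemma abs_mul_exp_le {c a d t : ℝ} (hc : 0 ≤ c) (ha : 0 < a) (ht : 0 ≤ t) :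
    |c * Real.exp ((d - t) / a)| ≤ c * Real.exp (d / a) := by
  rw [abs_of_nonneg (by positivity)]
  gcongr
  linarith

section Normalize

variable {E : Type*} [NormedAddCommGroup E] [NormedSpace ℝ E]

lemma norm_inv_norm_smul_le_one (z : E) : ‖‖z‖⁻¹ • z‖ ≤ 1 := by
  rw [norm_smul, norm_inv, norm_norm]
  exact inv_mul_le_one

lemma norm_normalize_sub_normalize_le {δ : ℝ} (hδ : 0 < δ) {z w : E} (hz : δ ≤ ‖z‖)
    (hw : δ ≤ ‖w‖) : ‖‖z‖⁻¹ • z - ‖w‖⁻¹ • w‖ ≤ 2 / δ * ‖z - w‖ := by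
  have hz0 : 0 < ‖z‖ := hδ.trans_le hz
  have hw0 : 0 < ‖w‖ := hδ.trans_le hw
  have hinv : |‖z‖⁻¹ - ‖w‖⁻¹| * ‖w‖ = ‖z‖⁻¹ * |‖w‖ - ‖z‖| := by
    rw [inv_sub_inv hz0.ne' hw0.ne', abs_div, abs_of_pos (mul_pos hz0 hw0)]
    field_simp
  calc ‖‖z‖⁻¹ • z - ‖w‖⁻¹ • w‖ = ‖‖z‖⁻¹ • (z - w) + (‖z‖⁻¹ - ‖w‖⁻¹) • w‖ := by
        congr 1; module
    _ ≤ ‖z‖⁻¹ * ‖z - w‖ + ‖z‖⁻¹ * |‖w‖ - ‖z‖| := by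
        refine (norm_add_le _ _).trans_eq ?_
        rw [norm_smul, norm_smul, norm_inv, norm_norm, Real.norm_eq_abs, hinv]
    _ ≤ δ⁻¹ * ‖z - w‖ + δ⁻¹ * ‖z - w‖ := by
        have := abs_norm_sub_norm_le w z
        rw [norm_sub_rev] at this
        gcongr
    _ = 2 / δ * ‖z - w‖ := by ring

lemma norm_smul_normalize_sub_le {δ B C p q : ℝ} (hδ : 0 < δ) {z w : E} (hz : δ ≤ ‖z‖)
    (hw : δ ≤ ‖w‖) (hq : |q| ≤ B) (hpq : |p - q| ≤ C * ‖z - w‖) :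
    ‖p • (‖z‖⁻¹ • z) - q • (‖w‖⁻¹ • w)‖ ≤ (C + B * (2 / δ)) * ‖z - w‖ := by
  calc ‖p • (‖z‖⁻¹ • z) - q • (‖w‖⁻¹ • w)‖
      = ‖(p - q) • (‖z‖⁻¹ • z) + q • (‖z‖⁻¹ • z - ‖w‖⁻¹ • w)‖ := by
        congr 1; module
    _ ≤ |p - q| * ‖‖z‖⁻¹ • z‖ + |q| * ‖‖z‖⁻¹ • z - ‖w‖⁻¹ • w‖ := by
        refine (norm_add_le _ _).trans_eq ?_
        rw [norm_smul (p - q), norm_smul q, Real.norm_eq_abs, Real.norm_eq_abs]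
    _ ≤ C * ‖z - w‖ * 1 + B * (2 / δ * ‖z - w‖) :=
        add_le_add
          (mul_le_mul hpq (norm_inv_norm_smul_le_one z) (norm_nonneg _)
            ((abs_nonneg _).trans hpq))
          (mul_le_mul hq (norm_normalize_sub_normalize_le hδ hz hw) (norm_nonneg _)
            ((abs_nonneg _).trans hq))
    _ = (C + B * (2 / δ)) * ‖z - w‖ := by ring

end Normalize

theorem stmt_13 (A R a r d δ : ℝ) (hA : 0 ≤ A) (hR : 0 ≤ R) (ha : 0 < a) (hr : 0 < r)
    (hd : 0 ≤ d) (hδ : 0 < δ) :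
    ∃ L > 0, ∀ x y x' y' : EuclideanSpace ℝ (Fin 2),
      δ ≤ ‖x - y‖ → δ ≤ ‖x' - y'‖ →
      ‖morseK A R a r d x y - morseK A R a r d x' y'‖ ≤ L * (‖x - x'‖ + ‖y - y'‖) := by
  have hAa : 0 ≤ A / a := by positivity
  have hRr : 0 ≤ R / r := by positivity
  set B : ℝ := A / a * Real.exp (d / a) + R / r * Real.exp (d / r)
  set C : ℝ := A / a * Real.exp (d / a) / a + R / r * Real.exp (d / r) / r with hC
  have hL : 0 ≤ C + B * (2 / δ) := by positivity
  refine ⟨C + B * (2 / δ) + 1, by positivity, fun x y x' y' hz hw => ?_⟩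
  have hdiff : ‖(x - y) - (x' - y')‖ ≤ ‖x - x'‖ + ‖y - y'‖ := by
    rw [sub_sub_sub_comm]
    exact norm_sub_le _ _
  have hbound : |A / a * Real.exp ((d - ‖x' - y'‖) / a) -
      R / r * Real.exp ((d - ‖x' - y'‖) / r)| ≤ B :=
    (abs_sub _ _).trans (add_le_add (abs_mul_exp_le hAa ha (norm_nonneg _))
      (abs_mul_exp_le hRr hr (norm_nonneg _)))
  have hlip : |(A / a * Real.exp ((d - ‖x - y‖) / a) - R / r * Real.exp ((d - ‖x - y‖) / r)) -
      (A / a * Real.exp ((d - ‖x' - y'‖) / a) - R / r * Real.exp ((d - ‖x' - y'‖) / r))| ≤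
      C * ‖(x - y) - (x' - y')‖ := by
    rw [sub_sub_sub_comm]
    calc _ ≤ _ := abs_sub _ _
      _ ≤ _ := add_le_add
        (abs_mul_exp_sub_mul_exp_le hAa ha (norm_nonneg _) (norm_nonneg _))
        (abs_mul_exp_sub_mul_exp_le hRr hr (norm_nonneg _) (norm_nonneg _))
      _ = C * |‖x - y‖ - ‖x' - y'‖| := by rw [hC]; ring
      _ ≤ _ := by
        gcongr
        exact abs_norm_sub_norm_le _ _
  calc _ ≤ (C + B * (2 / δ)) * ‖(x - y) - (x' - y')‖ :=
        norm_smul_normalize_sub_le hδ hz hw hbound hlip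
    _ ≤ (C + B * (2 / δ) + 1) * (‖x - x'‖ + ‖y - y'‖) := by
        exact mul_le_mul (by linarith) hdiff (norm_nonneg _) (by linarith)
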